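/- arXiv:2312.03784 — 3 statements merged into one kernel-verified Lean document; each statement's English description precedes it below -/
import Mathlib

section
/- For the Ahlswede distortion measure, for every probability distribution P on 𝒳 and every Δ ≥ 0, letting λ = ∑_{x∈𝒳_A} P(x), one has R(Δ | λQ_A + (1−λ)Q_B) ≥ R(Δ|P). -/
open scoped BigOperators

/-- `p` is a probability distribution on the finite set `X`. -/
def IsDist {X : Type*} [Fintype X] (p : X → ℝ) : Prop :=
  (∀ x, 0 ≤ p x) ∧ ∑ x, p x = 1

/-- `V` is a conditional probability distribution on `Y` given `X`. -/
def IsCondDist {X Y : Type*} [Fintype Y] (V : X → Y → ℝ) : Prop :=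
  ∀ x, IsDist (V x)

/-- Mutual information `I(q,V)` with the convention `0 log 0 = 0`. -/
noncomputable def mutInfo {X Y : Type*} [Fintype X] [Fintype Y]
    (q : X → ℝ) (V : X → Y → ℝ) : ℝ :=
  ∑ x, ∑ y, if q x * V x y = 0 then 0
    else q x * V x y * Real.log (V x y / ∑ x', q x' * V x' y)

/-- The rate-distortion function `R(Δ|q)`. -/
noncomputable def rateDist {X Y : Type*} [Fintype X] [Fintype Y]
    (d : X → Y → ℝ) (Δ : ℝ) (q : X → ℝ) : ℝ :=
  sInf { r | ∃ V : X → Y → ℝ, IsCondDist V ∧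
    (∑ x, ∑ y, q x * V x y * d x y) ≤ Δ ∧ r = mutInfo q V }

/-- Relative entropy `D(q‖P)` (real-valued; convention `0 log 0 = 0`). -/
noncomputable def relEnt {X : Type*} [Fintype X] (q P : X → ℝ) : ℝ :=
  ∑ x, if q x = 0 then 0 else q x * Real.log (q x / P x)

/-- Absolute continuity: `q(x) = 0` whenever `P(x) = 0` (finiteness of `D(q‖P)`). -/
def AbsCont {X : Type*} (q P : X → ℝ) : Prop := ∀ x, P x = 0 → q x = 0


/-- Ahlswede's distortion measure on `X = Y` partitioned into `A` and `B`. -/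
noncomputable def dAhl {X : Type*} [DecidableEq X] (A B : Finset X) (a b : ℝ)
    (x y : X) : ℝ :=
  if x = y then 0
  else if x ∈ A ∧ y ∈ A then 1
  else if x ∈ B ∧ y ∈ B then a
  else b

/-- The uniform distribution on the finite set `A`, extended by zero. -/
noncomputable def unifOn {X : Type*} [DecidableEq X] (A : Finset X) (x : X) : ℝ :=
  if x ∈ A then (A.card : ℝ)⁻¹ else 0

/-- The mixture `Q_λ = λ Q_A + (1-λ) Q_B` of the uniform distributions. -/
noncomputable def Qmix {X : Type*} [DecidableEq X] (A B : Finset X) (lam : ℝ)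
    (x : X) : ℝ :=
  lam * unifOn A x + (1 - lam) * unifOn B x

/-- Binary divergence `D₂(p‖q)`. -/
noncomputable def D2 (p q : ℝ) : ℝ :=
  p * Real.log (p / q) + (1 - p) * Real.log ((1 - p) / (1 - q))

open scoped Pointwise

section LogSum

variable {ι : Type*} [Fintype ι]

/-- The log-sum inequality. -/
theorem log_sum_inequality (u v : ι → ℝ) (hu : ∀ i, 0 ≤ u i) (hv : ∀ i, 0 ≤ v i)
    (huv : ∀ i, v i = 0 → u i = 0) :
    (∑ i, u i) * Real.log ((∑ i, u i) / ∑ i, v i) ≤ ∑ i, u i * Real.log (u i / v i) := by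
  rcases (Finset.sum_nonneg fun i _ => hu i : 0 ≤ ∑ i, u i).eq_or_lt with hU | hU
  · have h0 : ∀ i, u i = 0 := fun i =>
      (Finset.sum_eq_zero_iff_of_nonneg fun i _ => hu i).1 hU.symm i (Finset.mem_univ i)
    simp [h0]
  have hV : 0 < ∑ i, v i := by
    refine (Finset.sum_nonneg fun i _ => hv i).lt_of_ne' fun h => hU.ne' ?_
    exact Finset.sum_eq_zero fun i hi =>
      huv i ((Finset.sum_eq_zero_iff_of_nonneg fun i _ => hv i).1 h i hi)
  set t := (∑ i, u i) / ∑ i, v i with ht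
  have htpos : 0 < t := div_pos hU hV
  have key : ∀ i, u i * Real.log t + (u i - v i * t) ≤ u i * Real.log (u i / v i) := by
    intro i
    rcases (hu i).eq_or_lt with h | h
    · simpa [← h] using mul_nonneg (hv i) htpos.le
    have hvi : 0 < v i := (hv i).lt_of_ne' fun h' => h.ne' (huv i h')
    have hlog := Real.one_sub_inv_le_log_of_pos (div_pos (div_pos h hvi) htpos)
    rw [Real.log_div (div_pos h hvi).ne' htpos.ne'] at hlog
    have hmul := mul_le_mul_of_nonneg_left hlog h.le
    have heq : u i * (1 - (u i / v i / t)⁻¹) = u i - v i * t := by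
      field_simp
    linarith
  have hsum := Finset.sum_le_sum fun i (_ : i ∈ Finset.univ) => key i
  rw [Finset.sum_add_distrib, Finset.sum_sub_distrib, ← Finset.sum_mul, ← Finset.sum_mul] at hsum
  have : (∑ i, v i) * t = ∑ i, u i := by
    rw [ht]; field_simp
  linarith

/-- Gibbs' inequality. -/
theorem gibbs_inequality (u v : ι → ℝ) (hu : IsDist u) (hv : IsDist v)
    (huv : ∀ i, v i = 0 → u i = 0) : 0 ≤ ∑ i, u i * Real.log (u i / v i) := by
  simpa [hu.2, hv.2] using log_sum_inequality u v hu.1 hv.1 huv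

end LogSum

section MutInfo

variable {X Y : Type*} [Fintype X] [Fintype Y]

/-- The output distribution of the channel `V` with input `q`. -/
def outDist (q : X → ℝ) (V : X → Y → ℝ) (y : Y) : ℝ := ∑ x, q x * V x y

theorem mutInfo_eq (q : X → ℝ) (V : X → Y → ℝ) :
    mutInfo q V = ∑ x, ∑ y, q x * V x y * Real.log (V x y / outDist q V y) := by
  unfold mutInfo outDist
  refine Finset.sum_congr rfl fun x _ => Finset.sum_congr rfl fun y _ => ?_
  split_ifs with h
  · rw [h, zero_mul]
  · rfl

theorem IsDist.outDist {q : X → ℝ} {V : X → Y → ℝ} (hq : IsDist q) (hV : IsCondDist V) :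
    IsDist (outDist q V) := by
  refine ⟨fun y => Finset.sum_nonneg fun x _ => mul_nonneg (hq.1 x) ((hV x).1 y), ?_⟩
  unfold _root_.outDist
  rw [Finset.sum_comm]
  simp [← Finset.mul_sum, (hV _).2, hq.2]

theorem eq_zero_of_outDist_eq_zero {q : X → ℝ} {V : X → Y → ℝ} (hq : IsDist q)
    (hV : IsCondDist V) {y : Y} (h : outDist q V y = 0) (x : X) : q x * V x y = 0 :=
  (Finset.sum_eq_zero_iff_of_nonneg fun x _ => mul_nonneg (hq.1 x) ((hV x).1 y)).1 h x
    (Finset.mem_univ x)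

theorem mutInfo_nonneg {q : X → ℝ} {V : X → Y → ℝ} (hq : IsDist q) (hV : IsCondDist V) :
    0 ≤ mutInfo q V := by
  rw [mutInfo_eq]
  refine Finset.sum_nonneg fun x _ => ?_
  simp only [mul_assoc, ← Finset.mul_sum]
  by_cases hx : q x = 0
  · simp [hx]
  · exact mul_nonneg (hq.1 x) (gibbs_inequality _ _ (hV x) (hq.outDist hV) fun y hy =>
      (mul_eq_zero.1 (eq_zero_of_outDist_eq_zero hq hV hy x)).resolve_left hx)

/-- Replacing the output distribution by any other distribution can only increase the
mutual information functional. -/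
theorem mutInfo_le_of_isDist {q : X → ℝ} {V : X → Y → ℝ} {r : Y → ℝ} (hq : IsDist q)
    (hV : IsCondDist V) (hr : IsDist r) (hac : ∀ y, r y = 0 → outDist q V y = 0) :
    mutInfo q V ≤ ∑ x, ∑ y, q x * V x y * Real.log (V x y / r y) := by
  have hgibbs := gibbs_inequality _ _ (hq.outDist hV) hr hac
  have hsplit : ∀ x y, q x * V x y * Real.log (V x y / r y)
      = q x * V x y * Real.log (V x y / outDist q V y)
        + q x * V x y * Real.log (outDist q V y / r y) := by
    intro x y
    by_cases h : q x * V x y = 0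
    · simp [h]
    have hs : outDist q V y ≠ 0 := fun h' => h (eq_zero_of_outDist_eq_zero hq hV h' x)
    have hr0 : r y ≠ 0 := fun h' => hs (hac y h')
    have hV0 : V x y ≠ 0 := right_ne_zero_of_mul h
    rw [Real.log_div hV0 hr0, Real.log_div hV0 hs, Real.log_div hs hr0]
    ring
  have hswap : ∑ x, ∑ y, q x * V x y * Real.log (outDist q V y / r y)
      = ∑ y, outDist q V y * Real.log (outDist q V y / r y) := by
    rw [Finset.sum_comm]
    exact Finset.sum_congr rfl fun y _ => (Finset.sum_mul ..).symm
  simp only [hsplit, Finset.sum_add_distrib, hswap]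
  rw [mutInfo_eq]
  linarith

end MutInfo

section GroupAverage

variable (G : Type*) [Group G] [Fintype G] {X Y : Type*} [MulAction G X] [MulAction G Y]

/-- The average of a function over the action of a finite group. -/
noncomputable def groupAvg (f : X → ℝ) (x : X) : ℝ :=
  (Fintype.card G : ℝ)⁻¹ * ∑ g : G, f (g • x)

theorem groupAvg_smul (f : X → ℝ) (h : G) (x : X) : groupAvg G f (h • x) = groupAvg G f x := by
  unfold groupAvg
  congr 1
  exact Fintype.sum_equiv (Equiv.mulRight h) _ _ fun g => by simp [mul_smul]

theorem groupAvg_nonneg {f : X → ℝ} (hf : ∀ x, 0 ≤ f x) (x : X) : 0 ≤ groupAvg G f x :=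
  mul_nonneg (by positivity) (Finset.sum_nonneg fun g _ => hf _)

theorem eq_zero_of_groupAvg_eq_zero {f : X → ℝ} (hf : ∀ x, 0 ≤ f x) {x : X}
    (h : groupAvg G f x = 0) : f x = 0 := by
  have hc : (Fintype.card G : ℝ)⁻¹ ≠ 0 := by simp
  have hsum := (mul_eq_zero.1 h).resolve_left hc
  simpa using (Finset.sum_eq_zero_iff_of_nonneg fun g _ => hf _).1 hsum (1 : G) (Finset.mem_univ _)

theorem sum_groupAvg_mul [Fintype X] (f : X → ℝ) {F : X → ℝ}
    (hF : ∀ (g : G) x, F (g • x) = F x) : ∑ x, groupAvg G f x * F x = ∑ x, f x * F x := by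
  have h : ∀ g : G, ∑ x, f (g • x) * F x = ∑ x, f x * F x := fun g => by
    simpa [hF] using Equiv.sum_comp (MulAction.toPerm g) fun x => f x * F x
  simp only [groupAvg, mul_assoc, Finset.sum_mul, ← Finset.mul_sum]
  rw [Finset.sum_comm]
  simp [h]

theorem sum_groupAvg [Fintype X] (f : X → ℝ) : ∑ x, groupAvg G f x = ∑ x, f x := by
  simpa using sum_groupAvg_mul G f (F := fun _ => 1) fun _ _ => rfl

theorem IsDist.groupAvg [Fintype X] {f : X → ℝ} (hf : IsDist f) : IsDist (groupAvg G f) :=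
  ⟨groupAvg_nonneg G hf.1, (sum_groupAvg G f).trans hf.2⟩

/-- The average of a channel over the diagonal action of a finite group. -/
noncomputable def channelAvg (V : X → Y → ℝ) (x : X) (y : Y) : ℝ :=
  groupAvg G (fun p : X × Y => V p.1 p.2) (x, y)

theorem channelAvg_smul (V : X → Y → ℝ) (g : G) (x : X) (y : Y) :
    channelAvg G V (g • x) (g • y) = channelAvg G V x y :=
  groupAvg_smul G (fun p : X × Y => V p.1 p.2) g (x, y)

theorem IsCondDist.channelAvg [Fintype Y] {V : X → Y → ℝ} (hV : IsCondDist V) :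
    IsCondDist (channelAvg G V) := by
  refine fun x => ⟨fun y => groupAvg_nonneg G (fun p : X × Y => (hV p.1).1 p.2) (x, y), ?_⟩
  have h : ∀ g : G, ∑ y, V (g • x) (g • y) = 1 := fun g =>
    (Equiv.sum_comp (MulAction.toPerm g) fun y => V (g • x) y).trans (hV _).2
  simp only [_root_.channelAvg, _root_.groupAvg, ← Finset.mul_sum, Prod.smul_mk]
  rw [Finset.sum_comm]
  simp [h]

variable {G}

theorem mul_channelAvg {q : X → ℝ} (hq : ∀ (g : G) x, q (g • x) = q x) (V : X → Y → ℝ)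
    (x : X) (y : Y) :
    q x * channelAvg G V x y = groupAvg G (fun p : X × Y => q p.1 * V p.1 p.2) (x, y) := by
  simp only [channelAvg, groupAvg, Prod.smul_mk, hq, ← Finset.mul_sum]
  ring

variable [Fintype X]

theorem outDist_channelAvg {q : X → ℝ} (hq : ∀ (g : G) x, q (g • x) = q x) (V : X → Y → ℝ)
    (y : Y) : outDist q (channelAvg G V) y = groupAvg G (outDist q V) y := by
  have h : ∀ g : G, ∑ x, q x * V (g • x) (g • y) = ∑ x, q x * V x (g • y) := fun g => by
    simpa [hq] using Equiv.sum_comp (MulAction.toPerm g) fun x => q x * V x (g • y)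
  simp only [outDist, mul_channelAvg hq]
  simp only [groupAvg, Prod.smul_mk, hq]
  rw [← Finset.mul_sum, Finset.sum_comm]
  simp only [h, outDist]

variable [Fintype Y]

theorem sum_mul_channelAvg_mul {q : X → ℝ} (hq : ∀ (g : G) x, q (g • x) = q x) (V : X → Y → ℝ)
    {d : X → Y → ℝ} (hd : ∀ (g : G) x y, d (g • x) (g • y) = d x y) :
    ∑ x, ∑ y, q x * channelAvg G V x y * d x y = ∑ x, ∑ y, q x * V x y * d x y := by
  simp only [mul_channelAvg hq]
  simpa [Fintype.sum_prod_type] using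
    sum_groupAvg_mul G (fun p : X × Y => q p.1 * V p.1 p.2) (F := fun p => d p.1 p.2)
      fun g p => hd g p.1 p.2

theorem sum_groupAvg_mul_mul (P : X → ℝ) {W F : X → Y → ℝ}
    (hW : ∀ (g : G) x y, W (g • x) (g • y) = W x y)
    (hF : ∀ (g : G) x y, F (g • x) (g • y) = F x y) :
    ∑ x, ∑ y, groupAvg G P x * W x y * F x y = ∑ x, ∑ y, P x * W x y * F x y := by
  simp only [mul_assoc, ← Finset.mul_sum]
  refine sum_groupAvg_mul G P fun g x => ?_
  rw [← Equiv.sum_comp (MulAction.toPerm g)]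
  simp [hW, hF]

/-- Averaging a channel does not increase the mutual information for an invariant input. -/
theorem mutInfo_channelAvg_le {q : X → ℝ} (hq : ∀ (g : G) x, q (g • x) = q x)
    (hqd : IsDist q) {V : X → Y → ℝ} (hV : IsCondDist V) :
    mutInfo q (channelAvg G V) ≤ mutInfo q V := by
  have hrhs := sum_groupAvg G
    fun p : X × Y => q p.1 * V p.1 p.2 * Real.log (V p.1 p.2 / outDist q V p.2)
  simp only [Fintype.sum_prod_type] at hrhs
  rw [mutInfo_eq, mutInfo_eq, ← hrhs]
  refine Finset.sum_le_sum fun x _ => Finset.sum_le_sum fun y _ => ?_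
  by_cases hx : q x = 0
  · simp [hx, groupAvg, hq]
  have hls := log_sum_inequality (fun g : G => V (g • x) (g • y))
    (fun g => outDist q V (g • y)) (fun g => (hV _).1 _) (fun g => (hqd.outDist hV).1 _)
    fun g h => (mul_eq_zero.1 (eq_zero_of_outDist_eq_zero hqd hV h (g • x))).resolve_left
      (by rwa [hq])
  have hc : (0 : ℝ) ≤ (Fintype.card G : ℝ)⁻¹ := by positivity
  have hc' : (Fintype.card G : ℝ)⁻¹ ≠ 0 := by simp
  rw [outDist_channelAvg hq]
  simp only [channelAvg, groupAvg, Prod.smul_mk, hq]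
  rw [mul_div_mul_left _ _ hc']
  calc _ = q x * (Fintype.card G : ℝ)⁻¹ * ((∑ g : G, V (g • x) (g • y)) *
        Real.log ((∑ g : G, V (g • x) (g • y)) / ∑ g : G, outDist q V (g • y))) := by ring
    _ ≤ q x * (Fintype.card G : ℝ)⁻¹ * ∑ g : G, V (g • x) (g • y) *
        Real.log (V (g • x) (g • y) / outDist q V (g • y)) :=
      mul_le_mul_of_nonneg_left hls (mul_nonneg (hqd.1 x) hc)
    _ = _ := by simp only [mul_assoc, ← Finset.mul_sum]; ring

/-- Averaging the input does not decrease the mutual information of an invariant channel. -/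
theorem mutInfo_le_mutInfo_groupAvg {P : X → ℝ} (hP : IsDist P) {W : X → Y → ℝ}
    (hWd : IsCondDist W) (hW : ∀ (g : G) x y, W (g • x) (g • y) = W x y) :
    mutInfo P W ≤ mutInfo (groupAvg G P) W := by
  have hq := hP.groupAvg G
  have hr : ∀ (g : G) y, outDist (groupAvg G P) W (g • y) = outDist (groupAvg G P) W y := by
    intro g y
    unfold outDist
    rw [← Equiv.sum_comp (MulAction.toPerm g)]
    simp [hW, groupAvg_smul]
  refine (mutInfo_le_of_isDist hP hWd (hq.outDist hWd) fun y hy => ?_).trans_eq ?_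
  · refine Finset.sum_eq_zero fun x _ => ?_
    rcases mul_eq_zero.1 (eq_zero_of_outDist_eq_zero hq hWd hy x) with h | h
    · rw [eq_zero_of_groupAvg_eq_zero G hP.1 h, zero_mul]
    · rw [h, mul_zero]
  · rw [mutInfo_eq]
    exact (sum_groupAvg_mul_mul P hW fun g x y => by rw [hW, hr]).symm

/-- For an invariant distortion measure, averaging the source over a finite group does not
decrease the rate-distortion function. -/
theorem rateDist_le_rateDist_groupAvg {d : X → Y → ℝ}
    (hd : ∀ (g : G) x y, d (g • x) (g • y) = d x y) {P : X → ℝ} (hP : IsDist P) {Δ : ℝ}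
    (hfeas : ∃ V : X → Y → ℝ, IsCondDist V ∧ ∑ x, ∑ y, groupAvg G P x * V x y * d x y ≤ Δ) :
    rateDist d Δ P ≤ rateDist d Δ (groupAvg G P) := by
  obtain ⟨V₀, hV₀, hΔ₀⟩ := hfeas
  refine le_csInf ⟨_, V₀, hV₀, hΔ₀, rfl⟩ ?_
  rintro _ ⟨V, hV, hΔ, rfl⟩
  have hinv := groupAvg_smul G P
  have hW := hV.channelAvg G
  have hle : mutInfo P (channelAvg G V) ≤ mutInfo (groupAvg G P) V :=
    (mutInfo_le_mutInfo_groupAvg hP hW (channelAvg_smul G V)).trans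
      (mutInfo_channelAvg_le hinv (hP.groupAvg G) hV)
  refine le_trans (csInf_le ⟨0, ?_⟩ ⟨channelAvg G V, hW, ?_, rfl⟩) hle
  · rintro _ ⟨V', hV', -, rfl⟩
    exact mutInfo_nonneg hP hV'
  · rwa [← sum_groupAvg_mul_mul P (channelAvg_smul G V) hd, sum_mul_channelAvg_mul hinv V hd]

/-- Averaging over a group acting transitively on an invariant finite set produces a function
which is constant on that set. -/
theorem groupAvg_eq_of_transitive {X : Type*} [MulAction G X] {S : Finset X}
    (hS : ∀ (g : G) x, g • x ∈ S ↔ x ∈ S)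
    (htrans : ∀ x ∈ S, ∀ y ∈ S, ∃ g : G, g • x = y) (P : X → ℝ) {x : X} (hx : x ∈ S) :
    groupAvg G P x = (∑ y ∈ S, P y) * (S.card : ℝ)⁻¹ := by
  have hcard : (S.card : ℝ) ≠ 0 := by exact_mod_cast (Finset.card_pos.2 ⟨x, hx⟩).ne'
  have hconst : ∑ y ∈ S, groupAvg G P y = S.card * groupAvg G P x := by
    rw [← nsmul_eq_mul]
    refine Finset.sum_eq_card_nsmul fun y hy => ?_
    obtain ⟨g, rfl⟩ := htrans x hx y hy
    exact groupAvg_smul G P g x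
  have hsum : ∑ y ∈ S, groupAvg G P y = ∑ y ∈ S, P y := by
    have h : ∀ g : G, ∑ y ∈ S, P (g • y) = ∑ y ∈ S, P y := fun g =>
      Finset.sum_equiv (MulAction.toPerm g) (fun y => (hS g y).symm) fun _ _ => rfl
    simp only [groupAvg, ← Finset.mul_sum]
    rw [Finset.sum_comm]
    simp [h]
  rw [← hsum, hconst]
  field_simp

end GroupAverage

/-- Ahlswede's lemma: mixing towards uniform within the parts does not
decrease the rate-distortion function. -/
theorem ahlswede_mixture_lemma
    {X : Type*} [Fintype X] [DecidableEq X] [Nonempty X]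
    (A B : Finset X) (hA : A.Nonempty) (hB : B.Nonempty)
    (hdisj : Disjoint A B) (hcover : A ∪ B = Finset.univ)
    (a b : ℝ) (ha : 0 < a) (hb : 0 < b)
    (P : X → ℝ) (hP : IsDist P) (Δ : ℝ) (hΔ : 0 ≤ Δ) :
    rateDist (dAhl A B a b) Δ P
      ≤ rateDist (dAhl A B a b) Δ (Qmix A B (∑ x ∈ A, P x)) := by
  classical
  have hBA : ∀ x, x ∈ B ↔ x ∉ A := fun x => by
    have h1 : x ∈ A ∪ B := hcover ▸ Finset.mem_univ x
    have h2 : x ∈ A → x ∉ B := fun h => Finset.disjoint_left.1 hdisj h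
    rw [Finset.mem_union] at h1
    tauto
  let G := MulAction.stabilizer (Equiv.Perm X) A
  let : Fintype G := Fintype.ofFinite G
  have hGA : ∀ (g : G) x, g • x ∈ A ↔ x ∈ A := fun g x => by
    have h := Finset.smul_mem_smul_finset_iff (s := A) (b := x) (g : Equiv.Perm X)
    rwa [MulAction.mem_stabilizer_iff.1 g.2] at h
  have hGB : ∀ (g : G) x, g • x ∈ B ↔ x ∈ B := fun g x => by rw [hBA, hBA, hGA]
  have hswap : ∀ x y, (x ∈ A ↔ y ∈ A) → ∃ g : G, g • x = y := by
    intro x y hxy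
    refine ⟨⟨Equiv.swap x y, ?_⟩, Equiv.swap_apply_left x y⟩
    rw [MulAction.mem_stabilizer_iff]
    refine Finset.eq_of_subset_of_card_le (fun z hz => ?_) (Finset.card_smul_finset _ _).ge
    obtain ⟨w, hw, rfl⟩ := Finset.mem_smul_finset.1 hz
    rw [Equiv.Perm.smul_def, Equiv.swap_apply_def]
    split_ifs with h1 h2
    · exact hxy.1 (h1 ▸ hw)
    · exact hxy.2 (h2 ▸ hw)
    · exact hw
  have hQ : Qmix A B (∑ x ∈ A, P x) = groupAvg G P := by
    have hsplit : 1 - ∑ x ∈ A, P x = ∑ x ∈ B, P x := by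
      rw [← hP.2, ← hcover, Finset.sum_union hdisj]
      ring
    funext x
    rw [Qmix, hsplit, unifOn, unifOn]
    by_cases hx : x ∈ A
    · have hxB : x ∉ B := fun h => (hBA x).1 h hx
      rw [groupAvg_eq_of_transitive hGA (fun x hx y hy => hswap x y (by simp [hx, hy])) P hx]
      simp [hx, hxB]
    · have hxB : x ∈ B := (hBA x).2 hx
      rw [groupAvg_eq_of_transitive hGB (fun x hx y hy => hswap x y
        (by simp [(hBA _).1 hx, (hBA _).1 hy])) P hxB]
      simp [hx, hxB]
  rw [hQ]
  refine rateDist_le_rateDist_groupAvg (G := G) (fun g x y => ?_) hP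
    ⟨fun x y => if x = y then 1 else 0, fun x => ⟨fun y => ?_, ?_⟩, ?_⟩
  · simp [dAhl, hGA, hGB]
  · dsimp only
    split_ifs <;> simp
  · simp
  · refine le_of_eq_of_le (Finset.sum_eq_zero fun x _ => Finset.sum_eq_zero fun y _ => ?_) hΔ
    by_cases h : x = y <;> simp [h, dAhl]
end

section
/- Suppose the distortion measure d satisfies max_x min_y d(x,y) = 0 and is not identically zero. Then for every Δ ≥ 0 and every ε > 0 there exists ξ > 0 such that for all probability distributions p and q on 𝒳 with ‖p − q‖₂ ≤ ξ one has |R(Δ|p) − R(Δ|q)| ≤ ε; consequently max_{q: ‖p−q‖₂ ≤ ξ} R(Δ|q) ≤ R(Δ|p) + ε and min_{q: ‖p−q‖₂ ≤ ξ} R(Δ|q) ≥ R(Δ|p) − ε for every p. -/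
open scoped BigOperators

/-- Mutual information as a function of the joint distribution: `H(X) + H(Y) - H(X, Y)`. -/
noncomputable def jointMutInfo {X Y : Type*} [Fintype X] [Fintype Y] (J : X → Y → ℝ) : ℝ :=
  ∑ x, Real.negMulLog (∑ y, J x y) + ∑ y, Real.negMulLog (∑ x, J x y)
    - ∑ x, ∑ y, Real.negMulLog (J x y)

theorem continuous_jointMutInfo {X Y : Type*} [Fintype X] [Fintype Y] :
    Continuous (jointMutInfo : (X → Y → ℝ) → ℝ) := by
  unfold jointMutInfo
  fun_prop

theorem IsDist.le_one {X : Type*} [Fintype X] {p : X → ℝ} (hp : IsDist p) (x : X) : p x ≤ 1 :=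
  hp.2 ▸ Finset.single_le_sum (fun i _ => hp.1 i) (Finset.mem_univ x)

theorem joint_mem_Icc {X Y : Type*} [Fintype X] [Fintype Y] {q : X → ℝ} {V : X → Y → ℝ}
    (hq : IsDist q) (hV : IsCondDist V) :
    (fun x y => q x * V x y) ∈ Set.Icc (0 : X → Y → ℝ) 1 :=
  ⟨fun x y => mul_nonneg (hq.1 x) ((hV x).1 y),
    fun x y => mul_le_one₀ (hq.le_one x) ((hV x).1 y) ((hV x).le_one y)⟩

theorem mutInfo_eq_jointMutInfo {X Y : Type*} [Fintype X] [Fintype Y] {q : X → ℝ}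
    {V : X → Y → ℝ} (hq : IsDist q) (hV : IsCondDist V) :
    mutInfo q V = jointMutInfo fun x y => q x * V x y := by
  have hnn : ∀ x y, 0 ≤ q x * V x y := fun x y => mul_nonneg (hq.1 x) ((hV x).1 y)
  have hX : ∀ x, Real.negMulLog (∑ y, q x * V x y)
      = ∑ y, -(q x * V x y * Real.log (q x)) := by
    intro x
    rw [Finset.sum_neg_distrib, ← Finset.sum_mul, ← Finset.mul_sum, (hV x).2, mul_one, Real.negMulLog,
      neg_mul]
  have hY : ∀ y, Real.negMulLog (∑ x, q x * V x y)
      = ∑ x, -(q x * V x y * Real.log (∑ x', q x' * V x' y)) := by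
    intro y
    rw [Finset.sum_neg_distrib, ← Finset.sum_mul, Real.negMulLog, neg_mul]
  simp only [jointMutInfo, hX, hY, mutInfo]
  rw [Finset.sum_comm (s := (Finset.univ : Finset Y)), ← Finset.sum_add_distrib,
    ← Finset.sum_sub_distrib]
  refine Finset.sum_congr rfl fun x _ => ?_
  rw [← Finset.sum_add_distrib, ← Finset.sum_sub_distrib]
  refine Finset.sum_congr rfl fun y _ => ?_
  split_ifs with h
  · simp [h]
  · obtain ⟨hqx, hVx⟩ := mul_ne_zero_iff.1 h
    have hs : (∑ x', q x' * V x' y) ≠ 0 := by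
      have h1 := Finset.single_le_sum (fun i _ => hnn i y) (Finset.mem_univ x)
      exact (lt_of_lt_of_le (lt_of_le_of_ne (hnn x y) (Ne.symm h)) h1).ne'
    rw [Real.negMulLog, Real.log_div hVx hs, Real.log_mul hqx hVx]
    ring

theorem exists_distortion_eq_zero {X Y : Type*} [Finite X] [Finite Y] [Nonempty Y]
    {d : X → Y → ℝ} (hd : ∀ x y, 0 ≤ d x y) (hd0 : (⨆ x, ⨅ y, d x y) = 0) (x : X) :
    ∃ y, d x y = 0 := by
  obtain ⟨y, hy⟩ := exists_eq_ciInf_of_finite (f := d x)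
  refine ⟨y, le_antisymm ?_ (hd x y)⟩
  rw [hy, ← hd0]
  exact le_ciSup (f := fun x => ⨅ y, d x y) (Set.finite_range _).bddAbove x

theorem isDist_ite_eq {Y : Type*} [Fintype Y] [DecidableEq Y] (y₀ : Y) :
    IsDist fun y => if y = y₀ then (1 : ℝ) else 0 :=
  ⟨fun y => by dsimp only; split_ifs <;> norm_num, by simp⟩

/-- A channel admissible for the source `p` can be modified to one admissible for `q`, moving each
entry of the joint distribution by at most `|p x - q x|`. -/
theorem exists_condDist_of_feasible {X Y : Type*} [Fintype X] [Fintype Y]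
    {d : X → Y → ℝ} (hd : ∀ x y, 0 ≤ d x y) (hz : ∀ x, ∃ y, d x y = 0)
    {p q : X → ℝ} (hp : IsDist p) {V : X → Y → ℝ} (hV : IsCondDist V) :
    ∃ W : X → Y → ℝ, IsCondDist W ∧
      (∑ x, ∑ y, q x * W x y * d x y) ≤ ∑ x, ∑ y, p x * V x y * d x y ∧
      ∀ x y, |p x * V x y - q x * W x y| ≤ |p x - q x| := by
  classical
  choose y₀ hy₀ using hz
  have key : ∀ x, ∃ w : Y → ℝ, IsDist w ∧
      (∀ y, q x * w y * d x y ≤ p x * V x y * d x y) ∧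
      ∀ y, |p x * V x y - q x * w y| ≤ |p x - q x| := by
    intro x
    rcases le_or_gt (q x) (p x) with h | h
    · refine ⟨V x, hV x, fun y => ?_, fun y => ?_⟩
      · exact mul_le_mul_of_nonneg_right (mul_le_mul_of_nonneg_right h ((hV x).1 y)) (hd x y)
      · rw [← sub_mul, abs_mul, abs_of_nonneg ((hV x).1 y)]
        exact mul_le_of_le_one_right (abs_nonneg _) ((hV x).le_one y)
    · have hq0 : 0 < q x := (hp.1 x).trans_lt h
      set e : Y → ℝ := fun y => if y = y₀ x then 1 else 0 with he
      have hdist : IsDist e := isDist_ite_eq (y₀ x)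
      have hmul : ∀ y, q x * (p x / q x * V x y + (1 - p x / q x) * e y)
          = p x * V x y + (q x - p x) * e y := by
        intro y
        field_simp
      have hr : p x / q x ≤ 1 := (div_le_one hq0).2 h.le
      refine ⟨fun y => p x / q x * V x y + (1 - p x / q x) * e y, ⟨fun y => ?_, ?_⟩,
        fun y => ?_, fun y => ?_⟩
      · exact add_nonneg (mul_nonneg (div_nonneg (hp.1 x) hq0.le) ((hV x).1 y))
          (mul_nonneg (sub_nonneg.2 hr) (hdist.1 y))
      · rw [Finset.sum_add_distrib, ← Finset.mul_sum, ← Finset.mul_sum, (hV x).2, hdist.2]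
        ring
      · rw [hmul]
        have : e y * d x y = 0 := by
          rw [he]
          dsimp only
          split_ifs with hy
          · rw [hy, hy₀, mul_zero]
          · rw [zero_mul]
        rw [add_mul, mul_assoc (q x - p x), this, mul_zero, add_zero]
      · rw [hmul, sub_add_cancel_left, abs_neg, abs_mul, abs_of_nonneg (hdist.1 y),
          abs_sub_comm (q x)]
        exact mul_le_of_le_one_right (abs_nonneg _) (hdist.le_one y)
  choose W hW hWd hWj using key
  exact ⟨W, hW, Finset.sum_le_sum fun x _ => Finset.sum_le_sum fun y _ => hWd x y, hWj⟩

theorem bddBelow_mutInfo {X Y : Type*} [Fintype X] [Fintype Y] (d : X → Y → ℝ) (Δ : ℝ)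
    {q : X → ℝ} (hq : IsDist q) :
    BddBelow { r | ∃ V : X → Y → ℝ, IsCondDist V ∧
      (∑ x, ∑ y, q x * V x y * d x y) ≤ Δ ∧ r = mutInfo q V } := by
  obtain ⟨b, hb⟩ := (isCompact_Icc (a := (0 : X → Y → ℝ)) (b := 1)).bddBelow_image
    continuous_jointMutInfo.continuousOn
  refine ⟨b, ?_⟩
  rintro r ⟨V, hV, -, rfl⟩
  rw [mutInfo_eq_jointMutInfo hq hV]
  exact hb (Set.mem_image_of_mem _ (joint_mem_Icc hq hV))

theorem nonempty_mutInfo {X Y : Type*} [Fintype X] [Fintype Y] {d : X → Y → ℝ}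
    (hz : ∀ x, ∃ y, d x y = 0) {Δ : ℝ} (hΔ : 0 ≤ Δ) (q : X → ℝ) :
    { r | ∃ V : X → Y → ℝ, IsCondDist V ∧
      (∑ x, ∑ y, q x * V x y * d x y) ≤ Δ ∧ r = mutInfo q V }.Nonempty := by
  classical
  choose y₀ hy₀ using hz
  exact ⟨_, fun x y => if y = y₀ x then 1 else 0, fun x => isDist_ite_eq (y₀ x),
    by simpa [hy₀] using hΔ, rfl⟩

theorem exists_rateDist_le_add {X Y : Type*} [Fintype X] [Fintype Y]
    {d : X → Y → ℝ} (hd : ∀ x y, 0 ≤ d x y) (hz : ∀ x, ∃ y, d x y = 0)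
    {Δ : ℝ} (hΔ : 0 ≤ Δ) {ε : ℝ} (hε : 0 < ε) :
    ∃ ξ : ℝ, 0 < ξ ∧ ∀ p q : X → ℝ, IsDist p → IsDist q →
      Real.sqrt (∑ x, (p x - q x) ^ 2) ≤ ξ → rateDist d Δ q ≤ rateDist d Δ p + ε := by
  have huc : UniformContinuousOn (jointMutInfo : (X → Y → ℝ) → ℝ) (Set.Icc 0 1) :=
    isCompact_Icc.uniformContinuousOn_of_continuous continuous_jointMutInfo.continuousOn
  obtain ⟨δ, hδ, hF⟩ := Metric.uniformContinuousOn_iff_le.1 huc ε hε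
  refine ⟨δ, hδ, fun p q hp hq hpq => ?_⟩
  rw [← sub_le_iff_le_add]
  refine le_csInf (nonempty_mutInfo hz hΔ p) ?_
  rintro r ⟨V, hV, hVd, rfl⟩
  obtain ⟨W, hW, hWd, hWj⟩ := exists_condDist_of_feasible (q := q) hd hz hp hV
  have hle : rateDist d Δ q ≤ mutInfo q W :=
    csInf_le (bddBelow_mutInfo d Δ hq) ⟨W, hW, hWd.trans hVd, rfl⟩
  have hdist : dist (fun x y => p x * V x y) (fun x y => q x * W x y) ≤ δ := by
    refine (dist_pi_le_iff hδ.le).2 fun x => (dist_pi_le_iff hδ.le).2 fun y => ?_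
    refine (hWj x y).trans (le_trans ?_ hpq)
    exact Real.abs_le_sqrt (Finset.single_le_sum (f := fun x => (p x - q x) ^ 2)
      (fun i _ => sq_nonneg _) (Finset.mem_univ x))
  have hI := hF _ (joint_mem_Icc hp hV) _ (joint_mem_Icc hq hW) hdist
  rw [← mutInfo_eq_jointMutInfo hp hV, ← mutInfo_eq_jointMutInfo hq hW, Real.dist_eq] at hI
  linarith [(abs_le.1 hI).1]

/-- Lemma 8: uniform continuity of the rate-distortion function in the
source distribution, with max/min consequences. -/
theorem rate_distortion_uniformly_continuous
    {X Y : Type*} [Fintype X] [Fintype Y] [Nonempty X] [Nonempty Y]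
    (d : X → Y → ℝ) (hd : ∀ x y, 0 ≤ d x y)
    (hd0 : (⨆ x, ⨅ y, d x y) = 0) (hdne : ∃ x y, d x y ≠ 0)
    (Δ : ℝ) (hΔ : 0 ≤ Δ) (ε : ℝ) (hε : 0 < ε) :
    ∃ ξ : ℝ, 0 < ξ ∧
      (∀ p q : X → ℝ, IsDist p → IsDist q →
        Real.sqrt (∑ x, (p x - q x) ^ 2) ≤ ξ →
        |rateDist d Δ p - rateDist d Δ q| ≤ ε) ∧
      (∀ p : X → ℝ, IsDist p →
        sSup { r | ∃ q : X → ℝ, IsDist q ∧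
            Real.sqrt (∑ x, (p x - q x) ^ 2) ≤ ξ ∧ r = rateDist d Δ q }
          ≤ rateDist d Δ p + ε ∧
        rateDist d Δ p - ε
          ≤ sInf { r | ∃ q : X → ℝ, IsDist q ∧
            Real.sqrt (∑ x, (p x - q x) ^ 2) ≤ ξ ∧ r = rateDist d Δ q }) := by
  obtain ⟨ξ, hξ, h⟩ :=
    exists_rateDist_le_add (X := X) hd (exists_distortion_eq_zero hd hd0) hΔ hε
  have habs : ∀ p q : X → ℝ, IsDist p → IsDist q →
      Real.sqrt (∑ x, (p x - q x) ^ 2) ≤ ξ → |rateDist d Δ p - rateDist d Δ q| ≤ ε := by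
    intro p q hp hq hpq
    have hqp : Real.sqrt (∑ x, (q x - p x) ^ 2) ≤ ξ := by
      rwa [Finset.sum_congr rfl fun x _ => sub_sq_comm (q x) (p x)]
    rw [abs_sub_le_iff]
    constructor <;> linarith [h p q hp hq hpq, h q p hq hp hqp]
  refine ⟨ξ, hξ, habs, fun p hp => ?_⟩
  have hne : { r | ∃ q : X → ℝ, IsDist q ∧
      Real.sqrt (∑ x, (p x - q x) ^ 2) ≤ ξ ∧ r = rateDist d Δ q }.Nonempty :=
    ⟨_, p, hp, by simpa using hξ.le, rfl⟩
  constructor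
  · refine csSup_le hne ?_
    rintro r ⟨q, hq, hpq, rfl⟩
    exact h p q hp hq hpq
  · refine le_csInf hne ?_
    rintro r ⟨q, hq, hpq, rfl⟩
    linarith [(abs_le.1 (habs p q hp hq hpq)).2]
end

section
/- For every probability distribution P on 𝒳, every E ∈ [0, E*] where E* = −log min{ P(x) : x ∈ 𝒳, P(x) > 0 }, and every ξ > 0, there exists δ > 0 such that for every probability distribution p on 𝒳 satisfying E − δ ≤ D(p‖P) ≤ E + δ, there exists a probability distribution q on 𝒳 with D(q‖P) = E and ‖p − q‖₂ ≤ ξ. -/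
open scoped BigOperators

theorem continuous_relEnt {X : Type*} [Fintype X] (P : X → ℝ) :
    Continuous fun q : X → ℝ => relEnt q P := by
  unfold relEnt
  refine continuous_finsetSum _ fun x _ => ?_
  by_cases hx : P x = 0
  · simpa [hx] using continuous_const
  · have h : (fun q : X → ℝ => if q x = 0 then 0 else q x * Real.log (q x / P x)) =
        fun q => P x * (q x / P x * Real.log (q x / P x)) := by
      funext q
      split_ifs with hq
      · simp [hq]
      · field_simp
    rw [h]
    exact continuous_const.mul
      (Real.continuous_mul_log.comp (by fun_prop : Continuous fun q : X → ℝ => q x / P x))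

theorem isCompact_setOf_isDist_and_absCont {X : Type*} [Fintype X] (P : X → ℝ) :
    IsCompact {p : X → ℝ | IsDist p ∧ AbsCont p P} := by
  have hclosed : IsClosed {p : X → ℝ | AbsCont p P} := by
    simp only [AbsCont, Set.ofPred_forall]
    exact isClosed_iInter fun x => isClosed_iInter fun _ =>
      isClosed_eq (continuous_apply x) continuous_const
  exact (isCompact_stdSimplex ℝ X).inter_right hclosed

/-- On a compact set, near-solutions of `f = c` lie in any given open set containing all the
solutions. -/
theorem IsCompact.exists_pos_forall_abs_sub_le_mem {α : Type*} [TopologicalSpace α]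
    {K U : Set α} (hK : IsCompact K) (hU : IsOpen U) {f : α → ℝ} (hf : ContinuousOn f K) {c : ℝ}
    (h : ∀ a ∈ K, f a = c → a ∈ U) :
    ∃ δ : ℝ, 0 < δ ∧ ∀ a ∈ K, |f a - c| ≤ δ → a ∈ U := by
  have hcont : ContinuousOn (fun a => |f a - c|) (K \ U) :=
    ((hf.mono Set.sdiff_subset).sub continuousOn_const).abs
  obtain hempty | hne := (K \ U).eq_empty_or_nonempty
  · exact ⟨1, one_pos, fun a ha _ => Set.sdiff_eq_empty.mp hempty ha⟩
  · obtain ⟨b, hb, hmin⟩ := (hK.diff hU).exists_isMinOn hne hcont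
    have hpos : 0 < |f b - c| :=
      abs_pos.mpr fun h0 => hb.2 (h b hb.1 (sub_eq_zero.mp h0))
    refine ⟨|f b - c| / 2, half_pos hpos, fun a ha hle => ?_⟩
    by_contra hau
    have : |f b - c| ≤ |f a - c| := hmin ⟨ha, hau⟩
    linarith

/-- Lemma 9: distributions with divergence close to `E` are `ℓ₂`-close to a
distribution with divergence exactly `E`. -/
theorem divergence_sphere_approximation
    {X : Type*} [Fintype X] [Nonempty X]
    (P : X → ℝ) (hP : IsDist P)
    (E : ℝ) (hE0 : 0 ≤ E)
    (hE1 : E ≤ -Real.log (sInf { t | ∃ x, 0 < P x ∧ t = P x }))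
    (ξ : ℝ) (hξ : 0 < ξ) :
    ∃ δ : ℝ, 0 < δ ∧
      ∀ p : X → ℝ, IsDist p → AbsCont p P →
        E - δ ≤ relEnt p P → relEnt p P ≤ E + δ →
        ∃ q : X → ℝ, IsDist q ∧ AbsCont q P ∧ relEnt q P = E ∧
          Real.sqrt (∑ x, (p x - q x) ^ 2) ≤ ξ := by
  let U : Set (X → ℝ) := ⋃ q ∈ {q | IsDist q ∧ AbsCont q P ∧ relEnt q P = E},
    {p | Real.sqrt (∑ x, (p x - q x) ^ 2) < ξ}
  have hU : IsOpen U := isOpen_biUnion fun q _ =>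
    isOpen_lt (by fun_prop) continuous_const
  obtain ⟨δ, hδ, hmem⟩ :=
    (isCompact_setOf_isDist_and_absCont P).exists_pos_forall_abs_sub_le_mem hU
      (continuous_relEnt P).continuousOn (c := E) fun p hp hpE =>
        Set.mem_biUnion (show p ∈ {q | IsDist q ∧ AbsCont q P ∧ relEnt q P = E} from
          ⟨hp.1, hp.2, hpE⟩) (by simpa using hξ)
  refine ⟨δ, hδ, fun p hp hpP hlo hhi => ?_⟩
  obtain ⟨q, ⟨hq, hqP, hqE⟩, hpq⟩ := Set.mem_iUnion₂.mp
    (hmem p ⟨hp, hpP⟩ (abs_le.mpr ⟨by linarith, by linarith⟩))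
  exact ⟨q, hq, hqP, hqE, le_of_lt hpq⟩
end
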